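/- Let F be a pliable family of subsets of a finite ground set V that satisfies symmetry and structural submodularity, let Ê be a set of edges on V, and let L be a laminar subfamily of F_Ê each of whose members crosses at least one member of C_Ê. Let S0∈L and let C0 be the unique member of C_Ê that crosses S0. Suppose there is no C∈C_Ê whose smallest containing member of L∪{V} is S0. Then S0 has at least one child in L (a member S'⊊S0 of L with no T∈L satisfying S'⊊T⊊S0), C0 crosses every child of S0, and S0\(C0 ∪ the union of all children of S0) is empty. -/

import Mathlib

/-- Two subsets `A, B` of the ground set `V` cross if all four sets
`A ∩ B`, `A \ B`, `B \ A`, `V \ (A ∪ B)` are nonempty. -/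
def Crosses {V : Type*} (A B : Set V) : Prop :=
  (A ∩ B).Nonempty ∧ (A \ B).Nonempty ∧ (B \ A).Nonempty ∧
    (Set.univ \ (A ∪ B)).Nonempty

/-- At least two of the four propositions hold. -/
def AtLeastTwo (p q r s : Prop) : Prop :=
  (p ∧ q) ∨ (p ∧ r) ∨ (p ∧ s) ∨ (q ∧ r) ∨ (q ∧ s) ∨ (r ∧ s)

/-- A family `F` of subsets of `V` (with `∅ ∉ F` and `V ∉ F`) is pliable if for
every pair `A, B ∈ F`, at least two of `A ∩ B`, `A ∪ B`, `A \ B`, `B \ A` are in `F`. -/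
def Pliable {V : Type*} (F : Set (Set V)) : Prop :=
  ∅ ∉ F ∧ Set.univ ∉ F ∧
    ∀ A ∈ F, ∀ B ∈ F, AtLeastTwo (A ∩ B ∈ F) (A ∪ B ∈ F) (A \ B ∈ F) (B \ A ∈ F)

/-- `F` satisfies symmetry: `S ∈ F` iff `V \ S ∈ F`. -/
def SymmFamily {V : Type*} (F : Set (Set V)) : Prop :=
  ∀ S : Set V, S ∈ F ↔ (Set.univ \ S) ∈ F

/-- `F` satisfies structural submodularity: for every crossing pair `A, B ∈ F`,
at least one of `A ∩ B`, `A ∪ B` is in `F` and at least one of `A \ B`, `B \ A` is in `F`. -/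
def StructSubmodular {V : Type*} (F : Set (Set V)) : Prop :=
  ∀ A ∈ F, ∀ B ∈ F, Crosses A B →
    ((A ∩ B ∈ F ∨ A ∪ B ∈ F) ∧ (A \ B ∈ F ∨ B \ A ∈ F))

/-- `δ_J(S)`: the edges (unordered pairs) of `J` with exactly one endpoint in `S`. -/
def cutLinks {V : Type*} (J : Set (Sym2 V)) (S : Set V) : Set (Sym2 V) :=
  {e ∈ J | ∃ x y, e = s(x, y) ∧ x ∈ S ∧ y ∉ S}

/-- `F_Ê`: the members of `F` not covered by the edge set `Ê`. -/
def uncovered {V : Type*} (F : Set (Set V)) (E : Set (Sym2 V)) : Set (Set V) :=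
  {S ∈ F | cutLinks E S = ∅}

/-- `C` is an inclusion-minimal member of `F`: `C ∈ F` and no proper subset of `C` is in `F`. -/
def MinimalIn {V : Type*} (F : Set (Set V)) (C : Set V) : Prop :=
  C ∈ F ∧ ∀ S : Set V, S ⊂ C → S ∉ F

/-- `C_Ê`: the family of inclusion-minimal members of `F_Ê`. -/
def cores {V : Type*} (F : Set (Set V)) (E : Set (Sym2 V)) : Set (Set V) :=
  {C | MinimalIn (uncovered F E) C}


/-- `S'` is a child of `S₀` in the laminar family `L`. -/
def IsChild {V : Type*} (L : Set (Set V)) (S₀ S' : Set V) : Prop :=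
  S' ∈ L ∧ S' ⊂ S₀ ∧ ¬ ∃ T ∈ L, S' ⊂ T ∧ T ⊂ S₀

/-- `S` is the smallest member of `Lst ∪ {V}` containing `C`. -/
def SmallestContaining {V : Type*} (Lst : Set (Set V)) (C S : Set V) : Prop :=
  C ⊆ S ∧ ∀ T ∈ insert Set.univ Lst, C ⊆ T → S ⊆ T

theorem Crosses.symm {V : Type*} {A B : Set V} (h : Crosses A B) : Crosses B A := by
  obtain ⟨h1, h2, h3, h4⟩ := h
  exact ⟨Set.inter_comm A B ▸ h1, h3, h2, Set.union_comm A B ▸ h4⟩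

theorem cutLinks_eq_empty_iff {V : Type*} {E : Set (Sym2 V)} {S : Set V} :
    cutLinks E S = ∅ ↔ ∀ x y, s(x, y) ∈ E → x ∈ S → y ∈ S := by
  constructor
  · intro h x y he hx
    by_contra hy
    have hm : s(x, y) ∈ cutLinks E S := ⟨he, x, y, rfl, hx, hy⟩
    rw [h] at hm
    exact hm
  · intro h
    refine Set.eq_empty_iff_forall_notMem.mpr ?_
    rintro e ⟨he, x, y, rfl, hx, hy⟩
    exact hy (h x y he hx)

theorem cutLinks_union_eq_empty {V : Type*} {E : Set (Sym2 V)} {A B : Set V}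
    (hA : cutLinks E A = ∅) (hB : cutLinks E B = ∅) : cutLinks E (A ∪ B) = ∅ := by
  rw [cutLinks_eq_empty_iff] at *
  rintro x y he (hx | hx)
  · exact Or.inl (hA x y he hx)
  · exact Or.inr (hB x y he hx)

theorem cutLinks_inter_eq_empty {V : Type*} {E : Set (Sym2 V)} {A B : Set V}
    (hA : cutLinks E A = ∅) (hB : cutLinks E B = ∅) : cutLinks E (A ∩ B) = ∅ := by
  rw [cutLinks_eq_empty_iff] at *
  rintro x y he ⟨hxA, hxB⟩
  exact ⟨hA x y he hxA, hB x y he hxB⟩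

theorem cutLinks_diff_eq_empty {V : Type*} {E : Set (Sym2 V)} {A B : Set V}
    (hA : cutLinks E A = ∅) (hB : cutLinks E B = ∅) : cutLinks E (A \ B) = ∅ := by
  rw [cutLinks_eq_empty_iff] at *
  rintro x y he ⟨hxA, hxB⟩
  exact ⟨hA x y he hxA, fun hy => hxB (hB y x (Sym2.eq_swap ▸ he) hy)⟩

theorem cutLinks_univ {V : Type*} (E : Set (Sym2 V)) : cutLinks E Set.univ = ∅ :=
  cutLinks_eq_empty_iff.mpr fun _ _ _ _ => Set.mem_univ _

theorem StructSubmodular.uncovered {V : Type*} {F : Set (Set V)} (hF : StructSubmodular F)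
    (E : Set (Sym2 V)) : StructSubmodular (uncovered F E) := by
  rintro A ⟨hA, hA'⟩ B ⟨hB, hB'⟩ hAB
  obtain ⟨h1, h2⟩ := hF A hA B hB hAB
  exact ⟨h1.imp (fun h => ⟨h, cutLinks_inter_eq_empty hA' hB'⟩)
      (fun h => ⟨h, cutLinks_union_eq_empty hA' hB'⟩),
    h2.imp (fun h => ⟨h, cutLinks_diff_eq_empty hA' hB'⟩)
      (fun h => ⟨h, cutLinks_diff_eq_empty hB' hA'⟩)⟩

theorem univ_diff_mem_uncovered {V : Type*} {F : Set (Set V)} (hF : SymmFamily F)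
    {E : Set (Sym2 V)} {S : Set V} (hS : S ∈ uncovered F E) :
    Set.univ \ S ∈ uncovered F E :=
  ⟨(hF S).mp hS.1, cutLinks_diff_eq_empty (cutLinks_univ E) hS.2⟩

theorem MinimalIn.eq_of_subset {V : Type*} {F : Set (Set V)} {C S : Set V}
    (hC : MinimalIn F C) (hS : S ∈ F) (h : S ⊆ C) : S = C := by
  by_contra hne
  exact hC.2 S (h.ssubset_of_ne hne) hS

theorem exists_core_subset {V : Type*} [Finite V] {F : Set (Set V)} {E : Set (Sym2 V)}
    {S : Set V} (hS : S ∈ uncovered F E) : ∃ C ∈ cores F E, C ⊆ S := by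
  obtain ⟨C, hCS, hC⟩ := (Set.toFinite (uncovered F E)).exists_le_minimal hS
  exact ⟨C, ⟨hC.prop, fun T hT hTm => hT.2 (hC.le_of_le hTm hT.1)⟩, hCS⟩

/-- A core meeting an uncovered set either lies inside it or crosses it. -/
theorem subset_or_crosses_of_core {V : Type*} {F : Set (Set V)} (hF : SymmFamily F)
    {E : Set (Sym2 V)} {C S : Set V} (hC : C ∈ cores F E) (hS : S ∈ uncovered F E)
    (hCS : (C ∩ S).Nonempty) : C ⊆ S ∨ Crosses C S := by
  by_cases h1 : C ⊆ S
  · exact Or.inl h1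
  refine Or.inr ⟨hCS, Set.sdiff_nonempty.mpr h1, ?_, ?_⟩
  · refine Set.sdiff_nonempty.mpr fun h => ?_
    exact h1 (hC.eq_of_subset hS h).ge
  · refine Set.sdiff_nonempty.mpr fun h => ?_
    have hsub : Set.univ \ S ⊆ C := fun x hx => (h hx.1).resolve_right hx.2
    have heq := hC.eq_of_subset (univ_diff_mem_uncovered hF hS) hsub
    obtain ⟨x, hxC, hxS⟩ := hCS
    rw [← heq] at hxC
    exact hxC.2 hxS

/-- If an uncovered set `A` crosses an uncovered set `B`, and `B \ A` is a proper part
of a core, then `A \ B` is uncovered. -/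
theorem diff_mem_uncovered_of_crosses {V : Type*} {F : Set (Set V)} (hF : StructSubmodular F)
    {E : Set (Sym2 V)} {A B C : Set V} (hC : C ∈ cores F E) (hA : A ∈ uncovered F E)
    (hB : B ∈ uncovered F E) (hAB : Crosses A B) (h : B \ A ⊂ C) :
    A \ B ∈ uncovered F E :=
  ((hF.uncovered E A hA B hB hAB).2).resolve_right (hC.2 _ h)

theorem IsChild.eq_of_inter_nonempty {V : Type*} {L : Set (Set V)}
    (hLam : ∀ A ∈ L, ∀ B ∈ L, A ⊆ B ∨ B ⊆ A ∨ Disjoint A B) {S₀ A B : Set V}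
    (hA : IsChild L S₀ A) (hB : IsChild L S₀ B) (h : (A ∩ B).Nonempty) : A = B := by
  by_contra hne
  rcases hLam A hA.1 B hB.1 with hAB | hBA | hd
  · exact hA.2.2 ⟨B, hB.1, hAB.ssubset_of_ne hne, hB.2.1⟩
  · exact hB.2.2 ⟨A, hA.1, hBA.ssubset_of_ne (Ne.symm hne), hA.2.1⟩
  · exact Set.not_disjoint_iff_nonempty_inter.mpr h hd

/-- Every nonempty set contained in `S₀` but whose smallest containing member is not `S₀`
lies inside a child of `S₀`. -/
theorem exists_child_of_not_smallestContaining {V : Type*} [Finite V] {L : Set (Set V)}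
    (hLam : ∀ A ∈ L, ∀ B ∈ L, A ⊆ B ∨ B ⊆ A ∨ Disjoint A B) {S₀ C : Set V} (hS₀ : S₀ ∈ L)
    (hne : C.Nonempty) (hCS : C ⊆ S₀) (hC : ¬ SmallestContaining L C S₀) :
    ∃ S', IsChild L S₀ S' ∧ C ⊆ S' := by
  have hT : ∃ T ∈ L, C ⊆ T ∧ ¬ S₀ ⊆ T := by
    by_contra! hcon
    refine hC ⟨hCS, ?_⟩
    rintro T (rfl | hT) hCT
    · exact Set.subset_univ _
    · exact hcon T hT hCT
  obtain ⟨T, hTL, hCT, hST⟩ := hT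
  have hTS : T ⊂ S₀ := by
    rcases hLam T hTL S₀ hS₀ with h | h | h
    · exact ⟨h, hST⟩
    · exact absurd h hST
    · obtain ⟨x, hx⟩ := hne
      exact absurd (hCS hx) (Set.disjoint_left.mp h (hCT hx))
  obtain ⟨M, hTM, hM⟩ := (Set.toFinite {T ∈ L | T ⊂ S₀}).exists_le_maximal
    (show T ∈ {T ∈ L | T ⊂ S₀} from ⟨hTL, hTS⟩)
  refine ⟨M, ⟨hM.prop.1, hM.prop.2, ?_⟩, hCT.trans hTM⟩
  rintro ⟨W, hWL, hMW, hWS⟩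
  exact hMW.2 (hM.le_of_ge ⟨hWL, hWS⟩ hMW.1)

/-- Lemma on empty remainder: if no core is mapped to `S₀`,
then `S₀` has at least one child, `C₀` crosses every child of `S₀`, and
`S₀ \ (C₀ ∪ ⋃ children)` is empty. -/
theorem stmt10 {V : Type*} [Fintype V] (F : Set (Set V)) (E : Set (Sym2 V))
    (L : Set (Set V))
    (hPl : Pliable F) (hSym : SymmFamily F) (hSub : StructSubmodular F)
    (hL : L ⊆ uncovered F E)
    (hLam : ∀ A ∈ L, ∀ B ∈ L, A ⊆ B ∨ B ⊆ A ∨ Disjoint A B)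
    (hcross : ∀ S ∈ L, ∃ C ∈ cores F E, Crosses S C)
    (S₀ : Set V) (hS₀ : S₀ ∈ L)
    (C₀ : Set V) (hC₀ : C₀ ∈ cores F E) (hC₀x : Crosses C₀ S₀)
    (hUniq : ∀ C ∈ cores F E, Crosses C S₀ → C = C₀)
    (hNoPsi : ¬ ∃ C ∈ cores F E, SmallestContaining L C S₀) :
    (∃ S', IsChild L S₀ S') ∧
    (∀ S', IsChild L S₀ S' → Crosses C₀ S') ∧
    S₀ \ (C₀ ∪ ⋃₀ {S' | IsChild L S₀ S'}) = ∅ := by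
  have hne : ∀ C ∈ cores F E, C.Nonempty := fun C hC =>
    Set.nonempty_iff_ne_empty.mpr fun h => hPl.1 (h ▸ hC.1.1)
  have hchild : ∀ C ∈ cores F E, C ⊆ S₀ → ∃ S', IsChild L S₀ S' ∧ C ⊆ S' := fun C hC hCS =>
    exists_child_of_not_smallestContaining hLam hS₀ (hne C hC) hCS fun h => hNoPsi ⟨C, hC, h⟩
  have hcr : ∀ S', IsChild L S₀ S' → Crosses C₀ S' := by
    intro S' hS'
    obtain ⟨C, hC, hSC⟩ := hcross S' hS'.1
    obtain ⟨x, hxS, hxC⟩ := hSC.1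
    rcases subset_or_crosses_of_core hSym hC (hL hS₀) ⟨x, hxC, hS'.2.1.1 hxS⟩ with h | h
    · obtain ⟨T, hT, hCT⟩ := hchild C hC h
      obtain rfl := hS'.eq_of_inter_nonempty hLam hT ⟨x, hxS, hCT hxC⟩
      obtain ⟨y, hyC, hyS⟩ := hSC.2.2.1
      exact absurd (hCT hyC) hyS
    · exact hUniq C hC h ▸ hSC.symm
  have hbase : S₀ \ C₀ ∈ uncovered F E := by
    refine diff_mem_uncovered_of_crosses hSub hC₀ (hL hS₀) hC₀.1 hC₀x.symm
      ⟨Set.sdiff_subset, fun h => ?_⟩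
    obtain ⟨x, hxC, hxS⟩ := hC₀x.1
    exact (h hxC).2 hxS
  refine ⟨?_, hcr, ?_⟩
  · obtain ⟨C, hC, hCS⟩ := exists_core_subset hbase
    obtain ⟨T, hT, -⟩ := hchild C hC (hCS.trans Set.sdiff_subset)
    exact ⟨T, hT⟩
  by_contra hR
  obtain ⟨r, hrS, hr⟩ := Set.nonempty_iff_ne_empty.mpr hR
  have hrem : S₀ \ (C₀ ∪ ⋃₀ {S' | IsChild L S₀ S'}) ∈ uncovered F E := by
    refine Set.Finite.induction_on_subset
      (motive := fun 𝒯 _ => S₀ \ (C₀ ∪ ⋃₀ 𝒯) ∈ uncovered F E) _ (Set.toFinite _) ?_ ?_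
    · simpa using hbase
    · intro B 𝒯 hB h𝒯 hBn ih
      have hcrB := hcr B hB
      obtain ⟨c, hcC, hcB⟩ := hcrB.1
      obtain ⟨d, hdC, hdB⟩ := hcrB.2.1
      obtain ⟨b, hbB, hbC⟩ := hcrB.2.2.1
      have hdisj : ∀ x ∈ B, x ∉ ⋃₀ 𝒯 := by
        rintro x hx ⟨T, hT, hxT⟩
        exact hBn (IsChild.eq_of_inter_nonempty hLam hB (h𝒯 hT) ⟨x, hx, hxT⟩ ▸ hT)
      have heq : S₀ \ (C₀ ∪ ⋃₀ insert B 𝒯) = (S₀ \ (C₀ ∪ ⋃₀ 𝒯)) \ B := by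
        rw [Set.sUnion_insert, Set.sdiff_sdiff, Set.union_assoc, Set.union_comm B]
      have hBA : B \ (S₀ \ (C₀ ∪ ⋃₀ 𝒯)) ⊆ C₀ := by
        rintro x ⟨hxB, hx⟩
        by_contra hxC
        exact hx ⟨hB.2.1.1 hxB, fun h => h.elim hxC (hdisj x hxB)⟩
      rw [heq]
      refine diff_mem_uncovered_of_crosses hSub hC₀ ih (hL hB.1)
        ⟨⟨b, ⟨hB.2.1.1 hbB, fun h => h.elim hbC (hdisj b hbB)⟩, hbB⟩,
          ⟨r, ⟨hrS, fun h => hr (Set.union_subset_union_right C₀ (Set.sUnion_mono h𝒯) h)⟩,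
            fun h => hr (Or.inr ⟨B, hB, h⟩)⟩,
          ⟨c, hcB, fun h => h.2 (Or.inl hcC)⟩,
          ⟨d, Set.mem_univ d, fun h => h.elim (fun h => h.2 (Or.inl hdC)) hdB⟩⟩
        ⟨hBA, fun h => hdB (h hdC).1⟩
  obtain ⟨C, hC, hCR⟩ := exists_core_subset hrem
  obtain ⟨T, hT, hCT⟩ := hchild C hC (hCR.trans Set.sdiff_subset)
  obtain ⟨x, hx⟩ := hne C hC
  exact (hCR hx).2 (Or.inr ⟨T, hT, hCT hx⟩)
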